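/- A datum (c,d,B) is gaussian-extremizable if and only if the scaling condition holds and there exist self-adjoint positive-definite operators V_i on E_i (1≤i≤k) and Π ∈ Π(V_1^{−1},…,V_k^{−1}) such that each operator B_j Λ_c Π Λ_c B_j* on E^j is invertible and Σ_{j=1}^m d_j Λ_c B_j* (B_j Λ_c Π Λ_c B_j*)^{−1} B_j Λ_c ≤ ⊕_{i=1}^k c_i V_i as self-adjoint operators on E_0. Moreover, any such (V_i)_{1≤i≤k} together with U_j := (B_j Λ_c Π Λ_c B_j*)^{−1} (1≤j≤m) are gaussian extremizers. -/

import Mathlib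

open MeasureTheory LinearMap
open scoped RealInnerProductSpace BigOperators NNReal ENNReal

noncomputable section

namespace FRBL

/-- A positive semidefinite (self-adjoint) operator on a real inner product space. -/
def PosSemidef {G : Type*} [NormedAddCommGroup G] [InnerProductSpace ℝ G]
    (A : G →ₗ[ℝ] G) : Prop :=
  A.IsSymmetric ∧ ∀ x : G, 0 ≤ ⟪A x, x⟫

/-- A positive definite (self-adjoint) operator on a real inner product space. -/
def PosDef {G : Type*} [NormedAddCommGroup G] [InnerProductSpace ℝ G]
    (A : G →ₗ[ℝ] G) : Prop :=
  A.IsSymmetric ∧ ∀ x : G, x ≠ 0 → 0 < ⟪A x, x⟫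

variable {k m : ℕ}
  (E : Fin k → Type*) (F : Fin m → Type*)
  [∀ i, NormedAddCommGroup (E i)] [∀ i, InnerProductSpace ℝ (E i)]
  [∀ i, FiniteDimensional ℝ (E i)]
  [∀ i, MeasurableSpace (E i)] [∀ i, BorelSpace (E i)]
  [∀ j, NormedAddCommGroup (F j)] [∀ j, InnerProductSpace ℝ (F j)]
  [∀ j, FiniteDimensional ℝ (F j)]
  [∀ j, MeasurableSpace (F j)] [∀ j, BorelSpace (F j)]
  (c : Fin k → ℝ) (d : Fin m → ℝ)
  (B : ∀ i j, E i →ₗ[ℝ] F j)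

/-- The pointwise domination hypothesis of the forward-reverse Brascamp-Lieb inequality. -/
def Hyp (f : ∀ i, E i → ℝ≥0) (g : ∀ j, F j → ℝ≥0) : Prop :=
  ∀ x : ∀ i, E i,
    (∏ i, f i (x i) ^ c i) ≤ ∏ j, g j (∑ i, c i • B i j (x i)) ^ d j

/-- `D₀` is an admissible constant for the forward-reverse Brascamp-Lieb inequality. -/
def IsBound (D₀ : ℝ) : Prop :=
  ∀ (f : ∀ i, E i → ℝ≥0) (g : ∀ j, F j → ℝ≥0),
    (∀ i, Measurable (f i)) → (∀ j, Measurable (g j)) →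
    Hyp E F c d B f g →
    (∏ i, (∫⁻ x, (f i x : ℝ≥0∞)) ^ c i) ≤
      ENNReal.ofReal (Real.exp D₀) * ∏ j, (∫⁻ y, (g j y : ℝ≥0∞)) ^ d j

/-- The best constant `D(c,d,B)` in the forward-reverse Brascamp-Lieb inequality. -/
def D : EReal :=
  sInf {x : EReal | ∃ D₀ : ℝ, x = (D₀ : EReal) ∧ IsBound E F c d B D₀}

/-- The gaussian constraint `Λ_c B* U_d B Λ_c ≤ V_c`, written via quadratic forms. -/
def GaussCon (V : ∀ i, E i →ₗ[ℝ] E i) (U : ∀ j, F j →ₗ[ℝ] F j) : Prop :=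
  ∀ x : ∀ i, E i,
    (∑ j, d j * ⟪U j (∑ i, c i • B i j (x i)), ∑ i, c i • B i j (x i)⟫) ≤
      ∑ i, c i * ⟪V i (x i), x i⟫

/-- The objective functional in the definition of the gaussian constant. -/
def gaussObj (V : ∀ i, E i →ₗ[ℝ] E i) (U : ∀ j, F j →ₗ[ℝ] F j) : ℝ :=
  (∑ j, d j * Real.log (LinearMap.det (U j)) -
    ∑ i, c i * Real.log (LinearMap.det (V i))) / 2

/-- The gaussian best constant `D_g(c,d,B)`. -/
def Dg : EReal :=
  sSup {x : EReal | ∃ (V : ∀ i, E i →ₗ[ℝ] E i) (U : ∀ j, F j →ₗ[ℝ] F j),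
    (∀ i, PosDef (V i)) ∧ (∀ j, PosDef (U j)) ∧ GaussCon E F c d B V U ∧
    x = (gaussObj E F c d V U : EReal)}

/-- The datum `(c,d,B)` is gaussian-extremizable: the supremum defining `D_g` is
finite and attained. -/
def GaussExt : Prop :=
  ∃ (V : ∀ i, E i →ₗ[ℝ] E i) (U : ∀ j, F j →ₗ[ℝ] F j),
    (∀ i, PosDef (V i)) ∧ (∀ j, PosDef (U j)) ∧ GaussCon E F c d B V U ∧
    Dg E F c d B = (gaussObj E F c d V U : EReal)

/-- The canonical linear equivalence between `E₀ = ⊕ᵢ Eᵢ` (as `PiLp 2`) and the pi type. -/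
def toPi : PiLp 2 E ≃ₗ[ℝ] ∀ i, E i := WithLp.linearEquiv 2 ℝ (∀ i, E i)

/-- Orthogonal projection `π_{E_i} : E₀ → E_i`. -/
def projL (i : Fin k) : PiLp 2 E →ₗ[ℝ] E i := (LinearMap.proj i).comp (toPi E).toLinearMap

/-- The embedding `E_i → E₀`. -/
def singleL (i : Fin k) : E i →ₗ[ℝ] PiLp 2 E :=
  (toPi E).symm.toLinearMap.comp (LinearMap.single ℝ E i)

/-- The map `B_j : E₀ → E^j`, `x ↦ ∑ᵢ B_{ij} π_{E_i} x`. -/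
def Bop (j : Fin m) : PiLp 2 E →ₗ[ℝ] F j := ∑ i, (B i j).comp (projL E i)

/-- `Λ_c = ⊕ᵢ cᵢ id_{E_i}` as an operator on `E₀`. -/
def Lam : PiLp 2 E →ₗ[ℝ] PiLp 2 E := ∑ i, c i • (singleL E i).comp (projL E i)

/-- The set `Π(A_1, …, A_k)` of positive semidefinite "couplings". -/
def Coupling (A : ∀ i, E i →ₗ[ℝ] E i) : Set (PiLp 2 E →ₗ[ℝ] PiLp 2 E) :=
  {P | PosSemidef P ∧ ∀ (i : Fin k) (v : E i),
    ⟪P (singleL E i v), singleL E i v⟫ = ⟪A i v, v⟫}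

/-- The scaling condition `∑ᵢ cᵢ dim Eᵢ = ∑ⱼ dⱼ dim E^j`. -/
def ScalingCond : Prop :=
  ∑ i, c i * (Module.finrank ℝ (E i) : ℝ) = ∑ j, d j * (Module.finrank ℝ (F j) : ℝ)

/-- A subspace `T ⊆ E₀` is of product form, i.e. `T = ⊕ᵢ π_{E_i} T`. -/
def ProductForm (T : Submodule ℝ (PiLp 2 E)) : Prop :=
  ∀ x ∈ T, ∀ i, singleL E i (projL E i x) ∈ T

/-- The dimension condition over product-form subspaces. -/
def DimCond : Prop :=
  ∀ T : Submodule ℝ (PiLp 2 E), ProductForm E T →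
    (∑ i, c i * (Module.finrank ℝ (T.map (projL E i)) : ℝ)) ≤
      ∑ j, d j * (Module.finrank ℝ (T.map (Bop E F B j)) : ℝ)

/-- A critical subspace. -/
def IsCritical (T : Submodule ℝ (PiLp 2 E)) : Prop :=
  T ≠ ⊥ ∧ T ≠ ⊤ ∧ ProductForm E T ∧
    ∑ i, c i * (Module.finrank ℝ (T.map (projL E i)) : ℝ) =
      ∑ j, d j * (Module.finrank ℝ (T.map (Bop E F B j)) : ℝ)

/-- The datum is simple if it has no critical subspace. -/
def Simple : Prop := ∀ T : Submodule ℝ (PiLp 2 E), ¬ IsCritical E F c d B T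

end FRBL

namespace FRBL

/-- `log det` with value `−∞` on operators with non-positive determinant
(in particular on singular positive-semidefinite operators). -/
def elogdet {G : Type*} [AddCommGroup G] [Module ℝ G] (A : G →ₗ[ℝ] G) : EReal :=
  if 0 < LinearMap.det A then ((Real.log (LinearMap.det A) : ℝ) : EReal) else ⊥

variable {k m : ℕ}
  (E : Fin k → Type*) (F : Fin m → Type*)
  [∀ i, NormedAddCommGroup (E i)] [∀ i, InnerProductSpace ℝ (E i)]
  [∀ i, FiniteDimensional ℝ (E i)]
  [∀ j, NormedAddCommGroup (F j)] [∀ j, InnerProductSpace ℝ (F j)]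
  [∀ j, FiniteDimensional ℝ (F j)]
  (c : Fin k → ℝ) (d : Fin m → ℝ)
  (B : ∀ i j, E i →ₗ[ℝ] F j)

/-- The map `Q_j := B_j Λ_c : E₀ → E^j`. -/
def BLam (j : Fin m) : PiLp 2 E →ₗ[ℝ] F j := (Bop E F B j).comp (Lam E c)

/-- The optimality condition of Theorem 2 (structure of gaussian extremizers):
each `B_j Λ_c Π Λ_c B_j*` is invertible and
`∑ⱼ dⱼ Λ_c B_j* (B_j Λ_c Π Λ_c B_j*)⁻¹ B_j Λ_c ≤ V_c` in the quadratic-form sense. -/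
def ExtCond (V : ∀ i, E i →ₗ[ℝ] E i) (P : PiLp 2 E →ₗ[ℝ] PiLp 2 E) : Prop :=
  (∀ j, IsUnit ((BLam E F c B j) ∘ₗ P ∘ₗ LinearMap.adjoint (BLam E F c B j))) ∧
  ∀ x : PiLp 2 E,
    (∑ j, d j * ⟪Ring.inverse ((BLam E F c B j) ∘ₗ P ∘ₗ LinearMap.adjoint (BLam E F c B j))
        (BLam E F c B j x), BLam E F c B j x⟫) ≤
      ∑ i, c i * ⟪V i (projL E i x), projL E i x⟫

/-- A geometric datum. -/
def Geometric : Prop :=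
  ScalingCond E F c d ∧
  ∃ S ∈ Coupling E (fun i => (LinearMap.id : E i →ₗ[ℝ] E i)),
    (∀ j, (BLam E F c B j) ∘ₗ S ∘ₗ LinearMap.adjoint (BLam E F c B j) = LinearMap.id) ∧
    ∀ x : PiLp 2 E, (∑ j, d j * ⟪BLam E F c B j x, BLam E F c B j x⟫) ≤ ⟪Lam E c x, x⟫

/-- Equivalence of data: `B'_j = C_j⁻¹ B_j C⁻¹` for invertible `C, C_j`. -/
def EquivData (B' : ∀ i j, E i →ₗ[ℝ] F j) : Prop :=
  ∃ (C : PiLp 2 E ≃ₗ[ℝ] PiLp 2 E) (Cj : ∀ j, F j ≃ₗ[ℝ] F j),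
    ∀ j, Bop E F B' j =
      ((Cj j).symm.toLinearMap ∘ₗ Bop E F B j) ∘ₗ C.symm.toLinearMap

/-- `V_c = ⊕ᵢ cᵢ Vᵢ` as an operator on `E₀`. -/
def blockDiag (V : ∀ i, E i →ₗ[ℝ] E i) : PiLp 2 E →ₗ[ℝ] PiLp 2 E :=
  ∑ i, c i • ((singleL E i) ∘ₗ (V i)) ∘ₗ (projL E i)

/-- `Θ = V_c − ∑ⱼ dⱼ Λ_c B_j* U_j B_j Λ_c`. -/
def Theta (V : ∀ i, E i →ₗ[ℝ] E i) (U : ∀ j, F j →ₗ[ℝ] F j) :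
    PiLp 2 E →ₗ[ℝ] PiLp 2 E :=
  blockDiag E c V -
    ∑ j, d j • (LinearMap.adjoint (BLam E F c B j) ∘ₗ (U j)) ∘ₗ (BLam E F c B j)

end FRBL

namespace FRBL

/-- Borel structure on submodules (inherited from the ambient space). -/
instance subBorel {G : Type*} [AddCommGroup G] [Module ℝ G] [TopologicalSpace G]
    [MeasurableSpace G] [BorelSpace G] (T : Submodule ℝ G) : BorelSpace ↥T :=
  Subtype.borelSpace (T : Set G)

/-- The maximal dimension of a subspace on which the self-adjoint operator `Q` is positive
definite; by Sylvester's law of inertia this is the number of positive eigenvalues of `Q`,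
counted with multiplicity. -/
def posIndex {H : Type*} [NormedAddCommGroup H] [InnerProductSpace ℝ H]
    (Q : H →ₗ[ℝ] H) : ℕ :=
  sSup {r : ℕ | ∃ W : Submodule ℝ H,
    (∀ x ∈ W, x ≠ 0 → 0 < ⟪Q x, x⟫) ∧ Module.finrank ℝ W = r}

/-- The standard gaussian probability measure on a Euclidean space. -/
def stdGaussian (G : Type*) [NormedAddCommGroup G] [InnerProductSpace ℝ G]
    [FiniteDimensional ℝ G] [MeasurableSpace G] [BorelSpace G] :
    Measure G :=
  volume.withDensity fun x =>
    ENNReal.ofReal ((2 * Real.pi) ^ (-(Module.finrank ℝ G : ℝ) / 2) *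
      Real.exp (-‖x‖ ^ 2 / 2))

/-- `K_s = (|s|^{1/s} |s'|^{1/s'})^{1/2}`. -/
def Kconst (s s' : ℝ) : ℝ := Real.sqrt (|s| ^ (1 / s) * |s'| ^ (1 / s'))

variable {k m : ℕ}
  (E : Fin k → Type*) (F : Fin m → Type*)
  [∀ i, NormedAddCommGroup (E i)] [∀ i, InnerProductSpace ℝ (E i)]
  [∀ i, FiniteDimensional ℝ (E i)]
  [∀ j, NormedAddCommGroup (F j)] [∀ j, InnerProductSpace ℝ (F j)]
  [∀ j, FiniteDimensional ℝ (F j)]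
  (c : Fin k → ℝ) (d : Fin m → ℝ)
  (B : ∀ i j, E i →ₗ[ℝ] F j)

/-- The objective functional `∑ⱼ dⱼ log det Uⱼ − ∑ᵢ cᵢ log det Vᵢ`. -/
def objective (V : ∀ i, E i →ₗ[ℝ] E i) (U : ∀ j, F j →ₗ[ℝ] F j) : ℝ :=
  ∑ j, d j * Real.log (LinearMap.det (U j)) - ∑ i, c i * Real.log (LinearMap.det (V i))

/-- Feasibility for the optimization problem defining `D_g`: positive definiteness
together with the constraint `Θ ≥ 0`. -/
def Admissible (V : ∀ i, E i →ₗ[ℝ] E i) (U : ∀ j, F j →ₗ[ℝ] F j) : Prop :=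
  (∀ i, PosDef (V i)) ∧ (∀ j, PosDef (U j)) ∧ PosSemidef (Theta E F c d B V U)

/-- Global maximality in the optimization problem defining `D_g`. -/
def IsGlobalMax (V : ∀ i, E i →ₗ[ℝ] E i) (U : ∀ j, F j →ₗ[ℝ] F j) : Prop :=
  Admissible E F c d B V U ∧
    ∀ V' U', Admissible E F c d B V' U' →
      objective E F c d V' U' ≤ objective E F c d V U

/-- Local maximality in the optimization problem defining `D_g`. -/
def IsLocalMax (V : ∀ i, E i →ₗ[ℝ] E i) (U : ∀ j, F j →ₗ[ℝ] F j) : Prop :=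
  Admissible E F c d B V U ∧
    ∃ ε : ℝ, 0 < ε ∧
      ∀ V' U', Admissible E F c d B V' U' →
        (∀ i, ‖LinearMap.toContinuousLinearMap (V' i - V i)‖ < ε) →
        (∀ j, ‖LinearMap.toContinuousLinearMap (U' j - U j)‖ < ε) →
        objective E F c d V' U' ≤ objective E F c d V U

end FRBL

namespace FRBL

section Operators

variable {G : Type*} [NormedAddCommGroup G] [InnerProductSpace ℝ G]

theorem det_ne_zero_of_isUnit {A : G →ₗ[ℝ] G} (hA : IsUnit A) : LinearMap.det A ≠ 0 :=
  (hA.map LinearMap.det).ne_zero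

theorem log_det_inverse {A : G →ₗ[ℝ] G} (hA : IsUnit A) :
    Real.log (LinearMap.det (Ring.inverse A)) = -Real.log (LinearMap.det A) := by
  have h : LinearMap.det (Ring.inverse A) * LinearMap.det A = 1 := by
    rw [← map_mul, Ring.inverse_mul_cancel _ hA, map_one]
  rw [eq_inv_of_mul_eq_one_left h, Real.log_inv]

theorem PosDef.posSemidef {A : G →ₗ[ℝ] G} (hA : PosDef A) : PosSemidef A :=
  ⟨hA.1, fun x => by
    rcases eq_or_ne x 0 with rfl | hx
    · simp
    · exact (hA.2 x hx).le⟩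

theorem apply_inverse {A : G →ₗ[ℝ] G} (hA : IsUnit A) (x : G) : A (Ring.inverse A x) = x := by
  rw [← Module.End.mul_apply, Ring.mul_inverse_cancel _ hA, Module.End.one_apply]

theorem inverse_apply {A : G →ₗ[ℝ] G} (hA : IsUnit A) (x : G) : Ring.inverse A (A x) = x := by
  rw [← Module.End.mul_apply, Ring.inverse_mul_cancel _ hA, Module.End.one_apply]

theorem inverse_inverse {A : G →ₗ[ℝ] G} (hA : IsUnit A) : Ring.inverse (Ring.inverse A) = A := by
  obtain ⟨u, rfl⟩ := hA
  simp

theorem PosDef.add_smul {A N : G →ₗ[ℝ] G} (hA : PosDef A) (hN : PosDef N) {t : ℝ} (ht : 0 ≤ t) :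
    PosDef (A + t • N) := by
  refine ⟨hA.1.add (hN.1.smul (by simp)), fun x hx => ?_⟩
  have h1 := hA.2 x hx
  have h2 := mul_nonneg ht (hN.2 x hx).le
  simpa [inner_add_left, inner_smul_left] using add_pos_of_pos_of_nonneg h1 h2

theorem PosDef.smul {A : G →ₗ[ℝ] G} (hA : PosDef A) {t : ℝ} (ht : 0 < t) :
    PosDef (t • A) :=
  ⟨hA.1.smul (by simp), fun x hx => by simpa [inner_smul_left] using mul_pos ht (hA.2 x hx)⟩

variable [FiniteDimensional ℝ G]

theorem hasDerivAt_det_one_add_smul (N : G →ₗ[ℝ] G) :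
    HasDerivAt (fun t : ℝ => LinearMap.det (1 + t • N)) (LinearMap.trace ℝ G N) 0 := by
  classical
  let b := Module.finBasis ℝ G
  have h : ∀ t : ℝ, LinearMap.det (1 + t • N) = 1 + LinearMap.trace ℝ G N * t +
      (Matrix.det (1 + (Polynomial.X : Polynomial ℝ) •
        (LinearMap.toMatrix b b N).map Polynomial.C)).divX.divX.eval t * t ^ 2 := by
    intro t
    rw [LinearMap.trace_eq_matrix_trace ℝ b, ← Matrix.det_one_add_smul, ← LinearMap.det_toMatrix b]
    simp [LinearMap.toMatrix_one]
  simp_rw [h]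
  set p := (Matrix.det (1 + (Polynomial.X : Polynomial ℝ) •
    (LinearMap.toMatrix b b N).map Polynomial.C)).divX.divX
  have h1 := (((hasDerivAt_id (0 : ℝ)).const_mul (LinearMap.trace ℝ G N)).const_add 1).add
    ((p.hasDerivAt 0).mul (hasDerivAt_pow 2 (0 : ℝ)))
  refine (h1.congr_deriv (by simp)).congr_of_eventuallyEq (Filter.Eventually.of_forall fun t => ?_)
  simp

theorem hasDerivAt_det_add_smul (A N : G →ₗ[ℝ] G) (t₀ : ℝ) (hA : IsUnit (A + t₀ • N)) :
    HasDerivAt (fun t : ℝ => LinearMap.det (A + t • N))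
      (LinearMap.det (A + t₀ • N) * LinearMap.trace ℝ G (Ring.inverse (A + t₀ • N) * N)) t₀ := by
  have h : ∀ t : ℝ, LinearMap.det (A + t • N) = LinearMap.det (A + t₀ • N) *
      LinearMap.det (1 + (t - t₀) • (Ring.inverse (A + t₀ • N) * N)) := by
    intro t
    rw [← LinearMap.det_comp]
    congr 1
    change _ = (A + t₀ • N) * (1 + (t - t₀) • (Ring.inverse (A + t₀ • N) * N))
    rw [mul_add, mul_smul_comm, ← mul_assoc, Ring.mul_inverse_cancel _ hA, mul_one, one_mul]
    module
  rw [funext h]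
  refine HasDerivAt.const_mul _ ?_
  have h1 := hasDerivAt_det_one_add_smul (Ring.inverse (A + t₀ • N) * N)
  rw [← sub_self t₀] at h1
  exact h1.comp_sub_const t₀ t₀

theorem hasDerivAt_log_det_add_smul (A N : G →ₗ[ℝ] G) (t₀ : ℝ) (hA : IsUnit (A + t₀ • N)) :
    HasDerivAt (fun t : ℝ => Real.log (LinearMap.det (A + t • N)))
      (LinearMap.trace ℝ G (Ring.inverse (A + t₀ • N) * N)) t₀ := by
  have h0 := det_ne_zero_of_isUnit hA
  convert (hasDerivAt_det_add_smul A N t₀ hA).log h0 using 1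
  rw [mul_div_cancel_left₀ _ h0]

theorem tendsto_log_det_add_smul_sub (A : G →ₗ[ℝ] G) {N : G →ₗ[ℝ] G} (hN : IsUnit N) :
    Filter.Tendsto (fun t : ℝ => Real.log (LinearMap.det (A + t • N)) -
      Module.finrank ℝ G * Real.log t) Filter.atTop (nhds (Real.log (LinearMap.det N))) := by
  have hN' : IsUnit (N + (0 : ℝ) • A) := by simpa using hN
  have h1 := (hasDerivAt_log_det_add_smul N A 0 hN').continuousAt.tendsto.comp
    tendsto_inv_atTop_zero
  have h2 : ∀ᶠ t : ℝ in Filter.atTop, LinearMap.det (N + t⁻¹ • A) ≠ 0 :=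
    (tendsto_inv_atTop_zero (𝕜 := ℝ)).eventually
      ((hasDerivAt_det_add_smul N A 0 hN').continuousAt.eventually_ne (det_ne_zero_of_isUnit hN'))
  simp only [zero_smul, add_zero] at h1
  refine h1.congr' ?_
  filter_upwards [h2, Filter.eventually_gt_atTop 0] with t ht ht0
  have h3 : A + t • N = t • (N + t⁻¹ • A) := by
    rw [smul_add, smul_smul, mul_inv_cancel₀ ht0.ne', one_smul, add_comm]
  rw [h3, LinearMap.det_smul, Real.log_mul (pow_ne_zero _ ht0.ne') ht, Real.log_pow]
  simp

theorem PosSemidef.isPositive {A : G →ₗ[ℝ] G} (hA : PosSemidef A) :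
    A.toContinuousLinearMap.IsPositive := by
  rw [LinearMap.isPositive_toContinuousLinearMap_iff, LinearMap.isPositive_iff]
  exact hA

theorem PosSemidef.exists_sum_rankOne {A : G →ₗ[ℝ] G} (hA : PosSemidef A) :
    ∃ (n : ℕ) (p : Fin n → G), ∀ x, A x = ∑ a, ⟪p a, x⟫ • p a := by
  obtain ⟨n, p, h⟩ := ContinuousLinearMap.isPositive_iff_eq_sum_rankOne.1 hA.isPositive
  refine ⟨n, p, fun x => ?_⟩
  have := congrArg (fun T => T x) h
  simpa using this

theorem trace_comp_sum_rankOne {ι : Type*} [Fintype ι] {A : G →ₗ[ℝ] G} {p : ι → G}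
    (h : ∀ x, A x = ∑ a, ⟪p a, x⟫ • p a) (X : G →ₗ[ℝ] G) :
    LinearMap.trace ℝ G (X * A) = ∑ a, ⟪X (p a), p a⟫ := by
  have : X * A = ∑ a, (InnerProductSpace.rankOne ℝ (X (p a)) (p a)).toLinearMap := by
    ext x
    simp [h, map_sum]
  rw [this, map_sum]
  simp [InnerProductSpace.trace_rankOne, real_inner_comm]

theorem PosDef.isUnit {A : G →ₗ[ℝ] G} (hA : PosDef A) : IsUnit A := by
  rw [LinearMap.isUnit_iff_ker_eq_bot, LinearMap.ker_eq_bot']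
  intro x hx
  by_contra h
  simpa [hx] using hA.2 x h

theorem PosSemidef.posDef_inverse {A : G →ₗ[ℝ] G} (hA : PosSemidef A) (hu : IsUnit A) :
    PosDef (Ring.inverse A) := by
  have hs : (Ring.inverse A).IsSymmetric := fun x y => by
    have := hA.1 (Ring.inverse A x) (Ring.inverse A y)
    rw [apply_inverse hu, apply_inverse hu] at this
    exact this.symm
  refine ⟨hs, fun x hx => ?_⟩
  have h0 : 0 ≤ ⟪Ring.inverse A x, x⟫ := by
    have := hA.2 (Ring.inverse A x)
    rwa [apply_inverse hu, real_inner_comm] at this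
  refine lt_of_le_of_ne h0 fun h => hx ?_
  obtain ⟨n, p, hp⟩ := hA.exists_sum_rankOne
  have h1 : ∑ a, ⟪p a, Ring.inverse A x⟫ ^ 2 = 0 := by
    rw [h]
    conv_rhs => rw [← apply_inverse hu x, inverse_apply hu, hp, inner_sum]
    exact Finset.sum_congr rfl fun a _ => by
      rw [inner_smul_right, real_inner_comm (p a), sq]
  rw [Finset.sum_eq_zero_iff_of_nonneg fun a _ => sq_nonneg _] at h1
  rw [← apply_inverse hu x, hp]
  exact Finset.sum_eq_zero fun a ha => by rw [pow_eq_zero_iff two_ne_zero |>.1 (h1 a ha), zero_smul]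

theorem PosDef.inverse {A : G →ₗ[ℝ] G} (hA : PosDef A) : PosDef (Ring.inverse A) :=
  hA.posSemidef.posDef_inverse hA.isUnit

theorem PosDef.eventually_add_smul {A X : G →ₗ[ℝ] G} (hA : PosDef A) (hX : X.IsSymmetric) :
    ∀ᶠ t : ℝ in nhds 0, PosDef (A + t • X) := by
  have hAc : Continuous A := A.continuous_of_finiteDimensional
  have hXc : Continuous X := X.continuous_of_finiteDimensional
  have h : ∀ᶠ t : ℝ in nhds 0, ∀ v ∈ Metric.sphere (0 : G) 1, 0 < ⟪(A + t • X) v, v⟫ := by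
    refine (isCompact_sphere (0 : G) 1).eventually_forall_of_forall_eventually fun v hv => ?_
    have hc : Continuous fun z : ℝ × G => ⟪(A + z.1 • X) z.2, z.2⟫ := by
      simp only [LinearMap.add_apply, LinearMap.smul_apply]
      fun_prop
    refine hc.continuousAt.eventually_const_lt ?_
    simpa using hA.2 v (by rintro rfl; simp at hv)
  filter_upwards [h] with t ht
  refine ⟨hA.1.add (hX.smul (by simp)), fun x hx => ?_⟩
  have h1 := ht (‖x‖⁻¹ • x) (by simp [norm_smul, hx])
  rw [map_smul, inner_smul_left, inner_smul_right] at h1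
  have h2 : 0 < ‖x‖⁻¹ := by positivity
  simp only [conj_trivial] at h1
  exact (mul_pos_iff_of_pos_left h2).1 ((mul_pos_iff_of_pos_left h2).1 h1)

/-- One half of the variational description of `(U⁻¹ + t U₀⁻¹)⁻¹` as an infimal convolution. -/
theorem PosDef.inner_inverse_add_smul_le {U U₀ : G →ₗ[ℝ] G} (hU : PosDef U) (hU₀ : PosDef U₀)
    {t : ℝ} (ht : 0 ≤ t) (a b : G) :
    ⟪Ring.inverse (Ring.inverse U + t • Ring.inverse U₀) (a + t • b), a + t • b⟫ ≤
      ⟪U a, a⟫ + t * ⟪U₀ b, b⟫ := by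
  have key : ∀ {W : G →ₗ[ℝ] G}, PosDef W → ∀ w a : G,
      2 * ⟪w, a⟫ ≤ ⟪W a, a⟫ + ⟪w, Ring.inverse W w⟫ := by
    intro W hW w a
    have h := hW.posSemidef.2 (a - Ring.inverse W w)
    have h' := hW.1 a (Ring.inverse W w)
    rw [apply_inverse hW.isUnit] at h'
    rw [map_sub, apply_inverse hW.isUnit, inner_sub_left, inner_sub_right, inner_sub_right, h',
      real_inner_comm w a] at h
    linarith
  have hM := (hU.inverse.add_smul hU₀.inverse ht).isUnit
  set w := Ring.inverse (Ring.inverse U + t • Ring.inverse U₀) (a + t • b) with hw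
  have h1 := key hU w a
  have h2 := mul_le_mul_of_nonneg_left (key hU₀ w b) ht
  have h3 : a + t • b = Ring.inverse U w + t • Ring.inverse U₀ w := by
    rw [← apply_inverse hM (a + t • b), ← hw]
    simp
  have h4 := congrArg (fun z => ⟪w, z⟫) h3
  simp only [inner_add_right, inner_smul_right] at h4 ⊢
  linarith

/-- The other half: the infimum in the infimal convolution is attained. -/
theorem PosDef.exists_inner_inverse_add_smul_eq {V V₀ : G →ₗ[ℝ] G} (hV : PosDef V)
    (hV₀ : PosDef V₀) {t : ℝ} (ht : 0 ≤ t) (x : G) :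
    ∃ a b : G, x = a + t • b ∧ ⟪V a, a⟫ + t * ⟪V₀ b, b⟫ =
      ⟪Ring.inverse (Ring.inverse V + t • Ring.inverse V₀) x, x⟫ := by
  have hM := (hV.inverse.add_smul hV₀.inverse ht).isUnit
  set w := Ring.inverse (Ring.inverse V + t • Ring.inverse V₀) x with hw
  have h3 : x = Ring.inverse V w + t • Ring.inverse V₀ w := by
    conv_lhs => rw [← apply_inverse hM x, ← hw]
    simp
  refine ⟨Ring.inverse V w, Ring.inverse V₀ w, h3, ?_⟩
  rw [apply_inverse hV.isUnit, apply_inverse hV₀.isUnit]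
  conv_rhs => rw [h3, inner_add_right, inner_smul_right]

end Operators

section Datum

variable {k m : ℕ} {E : Fin k → Type*} {F : Fin m → Type*}
  [∀ i, NormedAddCommGroup (E i)] [∀ i, InnerProductSpace ℝ (E i)]
  [∀ j, NormedAddCommGroup (F j)] [∀ j, InnerProductSpace ℝ (F j)]

theorem projL_apply (i : Fin k) (x : PiLp 2 E) : projL E i x = x i := rfl

theorem inner_singleL_left (i : Fin k) (v : E i) (x : PiLp 2 E) :
    ⟪singleL E i v, x⟫ = ⟪v, projL E i x⟫ := by
  rw [PiLp.inner_apply, Finset.sum_eq_single i]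
  · simp [singleL, toPi, projL]
  · intro l _ hl
    simp [singleL, toPi, hl]
  · simp

theorem BLam_apply (c : Fin k → ℝ) (B : ∀ i j, E i →ₗ[ℝ] F j) (j : Fin m) (x : PiLp 2 E) :
    BLam E F c B j x = ∑ i, c i • B i j (x i) := by
  have h : ∀ i, (Lam E c x) i = c i • x i := by
    intro i
    have : Lam E c x = ∑ l, c l • singleL E l (x l) := by
      simp [Lam, projL_apply]
    rw [this, WithLp.ofLp_sum, Finset.sum_apply, Finset.sum_eq_single i]
    · simp [singleL, toPi]
    · intro l _ hl
      simp [singleL, toPi, hl.symm]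
    · simp
  simp [BLam, Bop, projL_apply, h]

theorem gaussCon_iff (c : Fin k → ℝ) (d : Fin m → ℝ) (B : ∀ i j, E i →ₗ[ℝ] F j)
    (V : ∀ i, E i →ₗ[ℝ] E i) (U : ∀ j, F j →ₗ[ℝ] F j) :
    GaussCon E F c d B V U ↔ ∀ x : PiLp 2 E,
      ∑ j, d j * ⟪U j (BLam E F c B j x), BLam E F c B j x⟫ ≤
        ∑ i, c i * ⟪V i (projL E i x), projL E i x⟫ := by
  simp only [BLam_apply, projL_apply]
  exact ⟨fun h x => h fun i => x i, fun h x => h (WithLp.toLp 2 x)⟩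

theorem Dg_eq_gaussObj_iff {c : Fin k → ℝ} {d : Fin m → ℝ} {B : ∀ i j, E i →ₗ[ℝ] F j}
    {V : ∀ i, E i →ₗ[ℝ] E i} {U : ∀ j, F j →ₗ[ℝ] F j} (hV : ∀ i, PosDef (V i))
    (hU : ∀ j, PosDef (U j)) (hcon : GaussCon E F c d B V U) :
    Dg E F c d B = (gaussObj E F c d V U : EReal) ↔
      ∀ V' U', (∀ i, PosDef (V' i)) → (∀ j, PosDef (U' j)) → GaussCon E F c d B V' U' →
        gaussObj E F c d V' U' ≤ gaussObj E F c d V U := by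
  constructor
  · intro h V' U' hV' hU' hcon'
    rw [← EReal.coe_le_coe_iff, ← h]
    exact le_sSup ⟨V', U', hV', hU', hcon', rfl⟩
  · intro h
    refine le_antisymm (sSup_le ?_) (le_sSup ⟨V, U, hV, hU, hcon, rfl⟩)
    rintro _ ⟨V', U', hV', hU', hcon', rfl⟩
    exact EReal.coe_le_coe_iff.2 (h V' U' hV' hU' hcon')

variable [∀ i, FiniteDimensional ℝ (E i)] [∀ j, FiniteDimensional ℝ (F j)]

theorem adjoint_singleL (i : Fin k) : LinearMap.adjoint (singleL E i) = projL E i := by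
  refine LinearMap.ext fun x => ext_inner_left ℝ fun v => ?_
  rw [LinearMap.adjoint_inner_right, inner_singleL_left]

theorem adjoint_projL (i : Fin k) : LinearMap.adjoint (projL E i) = singleL E i := by
  rw [← adjoint_singleL, LinearMap.adjoint_adjoint]

theorem comp_comp_adjoint_apply_of_sum_rankOne {G H ι : Type*} [NormedAddCommGroup G]
    [InnerProductSpace ℝ G] [FiniteDimensional ℝ G] [NormedAddCommGroup H]
    [InnerProductSpace ℝ H] [FiniteDimensional ℝ H] [Fintype ι] {P : G →ₗ[ℝ] G} {p : ι → G}
    (h : ∀ x, P x = ∑ a, ⟪p a, x⟫ • p a) (Q : G →ₗ[ℝ] H) (y : H) :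
    (Q ∘ₗ P ∘ₗ LinearMap.adjoint Q) y = ∑ a, ⟪Q (p a), y⟫ • Q (p a) := by
  simp [h, LinearMap.adjoint_inner_right]

theorem PosSemidef.comp_comp_adjoint {G H : Type*} [NormedAddCommGroup G]
    [InnerProductSpace ℝ G] [FiniteDimensional ℝ G] [NormedAddCommGroup H]
    [InnerProductSpace ℝ H] [FiniteDimensional ℝ H] {P : G →ₗ[ℝ] G} (hP : PosSemidef P)
    (Q : G →ₗ[ℝ] H) : PosSemidef (Q ∘ₗ P ∘ₗ LinearMap.adjoint Q) := by
  refine ⟨fun x y => ?_, fun x => ?_⟩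
  · simp only [LinearMap.comp_apply]
    rw [← LinearMap.adjoint_inner_right Q, hP.1, LinearMap.adjoint_inner_left Q]
  · simp only [LinearMap.comp_apply]
    rw [← LinearMap.adjoint_inner_right Q]
    exact hP.2 _

theorem eq_projL_comp_of_mem_coupling {A : ∀ i, E i →ₗ[ℝ] E i} {P : PiLp 2 E →ₗ[ℝ] PiLp 2 E}
    (hP : P ∈ Coupling E A) (i : Fin k) (hA : (A i).IsSymmetric) :
    A i = projL E i ∘ₗ P ∘ₗ LinearMap.adjoint (projL E i) := by
  have hs := hA.sub (hP.1.comp_comp_adjoint (projL E i)).1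
  rw [← sub_eq_zero, ← hs.inner_map_self_eq_zero]
  intro v
  rw [LinearMap.sub_apply, inner_sub_left, ← hP.2 i v, sub_eq_zero, adjoint_projL,
    real_inner_comm, inner_singleL_left, real_inner_comm]
  rfl

theorem log_det_objective_le {c : Fin k → ℝ} {d : Fin m → ℝ} {Q : ∀ j, PiLp 2 E →ₗ[ℝ] F j}
    (hd : ∀ j, 0 ≤ d j) (hs : ScalingCond E F c d)
    {V V₀ : ∀ i, E i →ₗ[ℝ] E i} {U U₀ : ∀ j, F j →ₗ[ℝ] F j}
    (hV : ∀ i, PosDef (V i)) (hV₀ : ∀ i, PosDef (V₀ i))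
    (hU : ∀ j, PosDef (U j)) (hU₀ : ∀ j, PosDef (U₀ j))
    (hcon : ∀ x, ∑ j, d j * ⟪U j (Q j x), Q j x⟫ ≤
      ∑ i, c i * ⟪V i (projL E i x), projL E i x⟫)
    (hcon₀ : ∀ x, ∑ j, d j * ⟪U₀ j (Q j x), Q j x⟫ ≤
      ∑ i, c i * ⟪V₀ i (projL E i x), projL E i x⟫)
    {P : PiLp 2 E →ₗ[ℝ] PiLp 2 E} (hP : PosSemidef P)
    (hPV : ∀ i, Ring.inverse (V₀ i) = projL E i ∘ₗ P ∘ₗ LinearMap.adjoint (projL E i))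
    (hPU : ∀ j, Ring.inverse (U₀ j) = Q j ∘ₗ P ∘ₗ LinearMap.adjoint (Q j)) :
    ∑ j, d j * Real.log (LinearMap.det (U j)) - ∑ i, c i * Real.log (LinearMap.det (V i)) ≤
      ∑ j, d j * Real.log (LinearMap.det (U₀ j)) -
        ∑ i, c i * Real.log (LinearMap.det (V₀ i)) := by
  obtain ⟨n, p, hp⟩ := hP.exists_sum_rankOne
  have hVt : ∀ i {t : ℝ}, 0 ≤ t → PosDef (Ring.inverse (V i) + t • Ring.inverse (V₀ i)) :=
    fun i t ht => (hV i).inverse.add_smul (hV₀ i).inverse ht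
  have hUt : ∀ j {t : ℝ}, 0 ≤ t → PosDef (Ring.inverse (U j) + t • Ring.inverse (U₀ j)) :=
    fun j t ht => (hU j).inverse.add_smul (hU₀ j).inverse ht
  let ψ : ℝ → ℝ := fun t =>
    ∑ i, c i * Real.log (LinearMap.det (Ring.inverse (V i) + t • Ring.inverse (V₀ i))) -
      ∑ j, d j * Real.log (LinearMap.det (Ring.inverse (U j) + t • Ring.inverse (U₀ j)))
  have hψ : ∀ t : ℝ, 0 ≤ t → HasDerivAt ψ
      (∑ i, c i * LinearMap.trace ℝ (E i)
          (Ring.inverse (Ring.inverse (V i) + t • Ring.inverse (V₀ i)) * Ring.inverse (V₀ i)) -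
        ∑ j, d j * LinearMap.trace ℝ (F j)
          (Ring.inverse (Ring.inverse (U j) + t • Ring.inverse (U₀ j)) * Ring.inverse (U₀ j)))
      t := fun t ht =>
    (HasDerivAt.fun_sum fun i _ =>
      (hasDerivAt_log_det_add_smul _ _ t (hVt i ht).isUnit).const_mul (c i)).sub
    (HasDerivAt.fun_sum fun j _ =>
      (hasDerivAt_log_det_add_smul _ _ t (hUt j ht).isUnit).const_mul (d j))
  have hcont : ∀ t : ℝ, 0 ≤ t → ∀ x,
      ∑ j, d j * ⟪Ring.inverse (Ring.inverse (U j) + t • Ring.inverse (U₀ j)) (Q j x), Q j x⟫ ≤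
        ∑ i, c i * ⟪Ring.inverse (Ring.inverse (V i) + t • Ring.inverse (V₀ i)) (projL E i x),
          projL E i x⟫ := by
    intro t ht x
    choose a b hab heq using fun i =>
      (hV i).exists_inner_inverse_add_smul_eq (hV₀ i) ht (projL E i x)
    have hx : x = (toPi E).symm a + t • (toPi E).symm b := by
      ext i
      exact hab i
    have ha := hcon ((toPi E).symm a)
    have hb := mul_le_mul_of_nonneg_left (hcon₀ ((toPi E).symm b)) ht
    calc _ ≤ ∑ j, d j * (⟪U j (Q j ((toPi E).symm a)), Q j ((toPi E).symm a)⟫ +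
          t * ⟪U₀ j (Q j ((toPi E).symm b)), Q j ((toPi E).symm b)⟫) := by
          refine Finset.sum_le_sum fun j _ => mul_le_mul_of_nonneg_left ?_ (hd j)
          rw [hx, map_add, map_smul]
          exact (hU j).inner_inverse_add_smul_le (hU₀ j) ht _ _
      _ = ∑ j, d j * ⟪U j (Q j ((toPi E).symm a)), Q j ((toPi E).symm a)⟫ +
          t * ∑ j, d j * ⟪U₀ j (Q j ((toPi E).symm b)), Q j ((toPi E).symm b)⟫ := by
          rw [Finset.mul_sum, ← Finset.sum_add_distrib]
          exact Finset.sum_congr rfl fun j _ => by ring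
      _ ≤ ∑ i, c i * ⟪V i (a i), a i⟫ + t * ∑ i, c i * ⟪V₀ i (b i), b i⟫ := add_le_add ha hb
      _ = _ := by
          rw [Finset.mul_sum, ← Finset.sum_add_distrib]
          exact Finset.sum_congr rfl fun i _ => by rw [← heq]; ring
  have hmono : MonotoneOn ψ (Set.Ici 0) := by
    refine monotoneOn_of_hasDerivWithinAt_nonneg (convex_Ici 0)
      (fun t ht => (hψ t ht).continuousAt.continuousWithinAt)
      (fun t ht => (hψ t (interior_subset ht)).hasDerivWithinAt) fun t ht => ?_
    have ht' : (0 : ℝ) ≤ t := interior_subset ht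
    rw [sub_nonneg]
    have h1 := Finset.sum_le_sum fun (a : Fin n) (_ : a ∈ Finset.univ) => hcont t ht' (p a)
    rw [Finset.sum_comm, Finset.sum_comm (t := (Finset.univ : Finset (Fin k)))] at h1
    refine (le_of_eq ?_).trans (h1.trans (le_of_eq ?_))
    · refine Finset.sum_congr rfl fun j _ => ?_
      rw [← Finset.mul_sum, hPU j,
        trace_comp_sum_rankOne (comp_comp_adjoint_apply_of_sum_rankOne hp (Q j))]
    · refine Finset.sum_congr rfl fun i _ => ?_
      rw [← Finset.mul_sum, hPV i,
        trace_comp_sum_rankOne (comp_comp_adjoint_apply_of_sum_rankOne hp (projL E i))]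
  have hlim : Filter.Tendsto ψ Filter.atTop
      (nhds (∑ i, c i * Real.log (LinearMap.det (Ring.inverse (V₀ i))) -
        ∑ j, d j * Real.log (LinearMap.det (Ring.inverse (U₀ j))))) := by
    have h1 := (tendsto_finsetSum Finset.univ fun i _ =>
      (tendsto_log_det_add_smul_sub (Ring.inverse (V i)) (hV₀ i).inverse.isUnit).const_mul
        (c i)).sub (tendsto_finsetSum Finset.univ fun j _ =>
      (tendsto_log_det_add_smul_sub (Ring.inverse (U j)) (hU₀ j).inverse.isUnit).const_mul
        (d j))
    refine h1.congr fun t => ?_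
    have h2 := congrArg (· * Real.log t) hs
    simp only [Finset.sum_mul] at h2
    simp only [mul_sub, Finset.sum_sub_distrib, ← mul_assoc, h2, ψ]
    ring
  have h := ge_of_tendsto hlim (Filter.eventually_atTop.2 ⟨0, fun t ht =>
    hmono (Set.self_mem_Ici) ht ht⟩)
  simp only [ψ, zero_smul, add_zero, log_det_inverse (hV _).isUnit, log_det_inverse (hU _).isUnit,
    log_det_inverse (hV₀ _).isUnit, log_det_inverse (hU₀ _).isUnit, mul_neg,
    Finset.sum_neg_distrib] at h
  linarith

theorem exists_isSymmetric_inner_eq_rankOne {G : Type*} [NormedAddCommGroup G]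
    [InnerProductSpace ℝ G] [FiniteDimensional ℝ G] (f : (G →L[ℝ] G) →ₗ[ℝ] ℝ) :
    ∃ X : G →ₗ[ℝ] G, X.IsSymmetric ∧
      (∀ v, f (InnerProductSpace.rankOne ℝ v v) = ⟪X v, v⟫) ∧
      ∀ A : G →ₗ[ℝ] G, PosSemidef A →
        f A.toContinuousLinearMap = LinearMap.trace ℝ G (X * A) := by
  let e := stdOrthonormalBasis ℝ G
  let φ : G → G →ₗ[ℝ] ℝ := fun w =>
    { toFun := fun v => f (InnerProductSpace.rankOne ℝ v w)
      map_add' := by simp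
      map_smul' := by simp }
  let Z : G →ₗ[ℝ] G := ∑ a, (φ (e a)).smulRight (e a)
  have hZ : ∀ v, f (InnerProductSpace.rankOne ℝ v v) = ⟪Z v, v⟫ := by
    intro v
    conv_lhs => arg 2; arg 2; rw [← e.sum_repr' v]
    simp [Z, φ, sum_inner, inner_smul_left, mul_comm]
  have hX : ∀ v, f (InnerProductSpace.rankOne ℝ v v) =
      ⟪((1 / 2 : ℝ) • (Z + LinearMap.adjoint Z)) v, v⟫ := by
    intro v
    rw [hZ, LinearMap.smul_apply, LinearMap.add_apply, inner_smul_left, inner_add_left,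
      LinearMap.adjoint_inner_left, real_inner_comm]
    simp only [conj_trivial]
    ring
  refine ⟨(1 / 2 : ℝ) • (Z + LinearMap.adjoint Z), ?_, hX, fun A hA => ?_⟩
  · refine LinearMap.IsSymmetric.smul (by simp) fun x y => ?_
    simp only [LinearMap.add_apply, inner_add_left, inner_add_right,
      LinearMap.adjoint_inner_left, LinearMap.adjoint_inner_right]
    ring
  · obtain ⟨n, p, hp⟩ := hA.exists_sum_rankOne
    have hA' : A.toContinuousLinearMap = ∑ a, InnerProductSpace.rankOne ℝ (p a) (p a) := by
      ext x
      simp [hp]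
    rw [hA', map_sum, trace_comp_sum_rankOne hp]
    exact Finset.sum_congr rfl fun a _ => hX _

theorem isClosed_setOf_isPositive {G : Type*} [NormedAddCommGroup G] [InnerProductSpace ℝ G] :
    IsClosed {P : G →L[ℝ] G | P.IsPositive} := by
  have h : {P : G →L[ℝ] G | P.IsPositive} =
      (⋂ x, ⋂ y, {P : G →L[ℝ] G | ⟪P x, y⟫ = ⟪x, P y⟫}) ∩ ⋂ x, {P : G →L[ℝ] G | 0 ≤ ⟪P x, x⟫} := by
    ext P
    simp [ContinuousLinearMap.isPositive_iff, LinearMap.IsSymmetric]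
  rw [h]
  refine IsClosed.inter (isClosed_iInter fun x => isClosed_iInter fun y => ?_)
    (isClosed_iInter fun x => ?_)
  · exact isClosed_eq (by fun_prop) (by fun_prop)
  · exact isClosed_le (by fun_prop) (by fun_prop)

theorem isClosed_image_setOf_isPositive {G W : Type*} [NormedAddCommGroup G]
    [InnerProductSpace ℝ G] [FiniteDimensional ℝ G] [TopologicalSpace W] [SequentialSpace W]
    [T2Space W] {L : (G →L[ℝ] G) → W} (hL : Continuous L) {τ : W → ℝ} (hτ : Continuous τ)
    (h : ∀ P : G →L[ℝ] G, P.IsPositive → ‖P‖ ≤ τ (L P)) :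
    IsClosed (L '' {P | P.IsPositive}) := by
  refine IsSeqClosed.isClosed fun w w₀ hw hlim => ?_
  choose P hP hPw using hw
  obtain ⟨R, hR⟩ := ((hτ.tendsto w₀).comp hlim).bddAbove_range
  have hb : ∀ n, P n ∈ Metric.closedBall (0 : G →L[ℝ] G) R := by
    intro n
    rw [Metric.mem_closedBall, dist_zero_right]
    refine (h _ (hP n)).trans ?_
    rw [hPw]
    exact hR ⟨n, rfl⟩
  obtain ⟨P₀, -, φ, hφ, hφlim⟩ :=
    tendsto_subseq_of_bounded (Metric.isBounded_closedBall) hb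
  refine ⟨P₀, isClosed_setOf_isPositive.mem_of_tendsto hφlim
    (Filter.Eventually.of_forall fun n => hP _), ?_⟩
  refine tendsto_nhds_unique ((hL.tendsto P₀).comp hφlim) ?_
  refine (hlim.comp hφ.tendsto_atTop).congr fun n => ?_
  simp [hPw]

/-- The compressions of an operator on `E₀` to the `E i`, and its images under the `Q j`. -/
def compression (Q : ∀ j, PiLp 2 E →ₗ[ℝ] F j) :
    (PiLp 2 E →L[ℝ] PiLp 2 E) →ₗ[ℝ] (∀ i, E i →L[ℝ] E i) × (∀ j, F j →L[ℝ] F j) where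
  toFun P :=
    (fun i => (projL E i ∘ₗ P.toLinearMap ∘ₗ
        LinearMap.adjoint (projL E i)).toContinuousLinearMap,
      fun j => (Q j ∘ₗ P.toLinearMap ∘ₗ LinearMap.adjoint (Q j)).toContinuousLinearMap)
  map_add' P P' := by ext <;> simp
  map_smul' a P := by ext <;> simp

theorem compression_rankOne (Q : ∀ j, PiLp 2 E →ₗ[ℝ] F j) (x : PiLp 2 E) :
    compression Q (InnerProductSpace.rankOne ℝ x x) =
      (fun i => InnerProductSpace.rankOne ℝ (projL E i x) (projL E i x),
        fun j => InnerProductSpace.rankOne ℝ (Q j x) (Q j x)) := by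
  ext <;> simp [compression, LinearMap.adjoint_inner_right]

theorem norm_le_sum_trace_compression (Q : ∀ j, PiLp 2 E →ₗ[ℝ] F j)
    {P : PiLp 2 E →L[ℝ] PiLp 2 E} (hP : P.IsPositive) :
    ‖P‖ ≤ ∑ i, LinearMap.trace ℝ (E i) ((compression Q P).1 i).toLinearMap := by
  obtain ⟨n, u, rfl⟩ := ContinuousLinearMap.isPositive_iff_eq_sum_rankOne.1 hP
  have h : ∀ i, LinearMap.trace ℝ (E i) ((compression Q
      (∑ a, InnerProductSpace.rankOne ℝ (u a) (u a))).1 i).toLinearMap = ∑ a, ‖u a i‖ ^ 2 := by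
    intro i
    rw [map_sum, Prod.fst_sum, Finset.sum_apply, ContinuousLinearMap.toLinearMap_sum, map_sum]
    refine Finset.sum_congr rfl fun a _ => ?_
    rw [compression_rankOne, InnerProductSpace.trace_rankOne, real_inner_self_eq_norm_sq]
    rfl
  simp_rw [h]
  rw [Finset.sum_comm]
  refine norm_sum_le_of_le (E := PiLp 2 E →L[ℝ] PiLp 2 E) _ fun a _ => ?_
  rw [InnerProductSpace.norm_rankOne (𝕜 := ℝ) (u a) (u a), ← sq]
  exact (PiLp.norm_sq_eq_of_L2 E (u a)).le

theorem isClosed_compression_image (Q : ∀ j, PiLp 2 E →ₗ[ℝ] F j) :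
    IsClosed (compression Q '' {P | P.IsPositive}) := by
  refine isClosed_image_setOf_isPositive
    (τ := fun w => ∑ i, LinearMap.trace ℝ (E i) (w.1 i).toLinearMap)
    (LinearMap.continuous_of_finiteDimensional _) (continuous_finsetSum _ fun i _ => ?_)
    fun P hP => norm_le_sum_trace_compression Q hP
  have : Continuous fun A : E i →L[ℝ] E i => LinearMap.trace ℝ (E i) A.toLinearMap :=
    LinearMap.continuous_of_finiteDimensional
      (LinearMap.trace ℝ (E i) ∘ₗ ContinuousLinearMap.coeLM ℝ)
  exact this.comp ((continuous_apply i).comp continuous_fst)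

/-- Existence of a positive semidefinite Lagrange multiplier. -/
theorem exists_posSemidef_multiplier (Q : ∀ j, PiLp 2 E →ₗ[ℝ] F j)
    {A : ∀ i, E i →ₗ[ℝ] E i} {C : ∀ j, F j →ₗ[ℝ] F j}
    (hA : ∀ i, PosSemidef (A i)) (hC : ∀ j, PosSemidef (C j))
    (h : ∀ (X : ∀ i, E i →ₗ[ℝ] E i) (Y : ∀ j, F j →ₗ[ℝ] F j),
      (∀ i, (X i).IsSymmetric) → (∀ j, (Y j).IsSymmetric) →
      (∀ x, 0 ≤ ∑ i, ⟪X i (projL E i x), projL E i x⟫ + ∑ j, ⟪Y j (Q j x), Q j x⟫) →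
      0 ≤ ∑ i, LinearMap.trace ℝ (E i) (X i * A i) +
        ∑ j, LinearMap.trace ℝ (F j) (Y j * C j)) :
    ∃ P : PiLp 2 E →ₗ[ℝ] PiLp 2 E, PosSemidef P ∧
      (∀ i, A i = projL E i ∘ₗ P ∘ₗ LinearMap.adjoint (projL E i)) ∧
      ∀ j, C j = Q j ∘ₗ P ∘ₗ LinearMap.adjoint (Q j) := by
  let K : ProperCone ℝ ((∀ i, E i →L[ℝ] E i) × (∀ j, F j →L[ℝ] F j)) :=
    { carrier := compression Q '' {P | P.IsPositive}
      add_mem' := by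
        rintro _ _ ⟨P, hP, rfl⟩ ⟨P', hP', rfl⟩
        exact ⟨P + P', hP.add hP', map_add _ _ _⟩
      zero_mem' := ⟨0, ContinuousLinearMap.isPositive_zero, map_zero _⟩
      smul_mem' := by
        rintro ⟨r, hr⟩ _ ⟨P, hP, rfl⟩
        exact ⟨r • P, hP.smul_of_nonneg hr, map_smul _ _ _⟩
      isClosed' := isClosed_compression_image Q }
  by_cases hmem : ((fun i => (A i).toContinuousLinearMap, fun j => (C j).toContinuousLinearMap) :
      (∀ i, E i →L[ℝ] E i) × (∀ j, F j →L[ℝ] F j)) ∈ K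
  · obtain ⟨P, hP, hPe⟩ := hmem
    refine ⟨P.toLinearMap, (ContinuousLinearMap.isPositive_iff P).1 hP, fun i => ?_, fun j => ?_⟩
    · have := congrFun (congrArg Prod.fst hPe) i
      exact (LinearMap.toContinuousLinearMap.injective this).symm
    · have := congrFun (congrArg Prod.snd hPe) j
      exact (LinearMap.toContinuousLinearMap.injective this).symm
  · exfalso
    obtain ⟨f, hf, hf₀⟩ := K.hyperplane_separation_point hmem
    choose X hXs hX hXA using fun i => exists_isSymmetric_inner_eq_rankOne
      (f.toLinearMap ∘ₗ LinearMap.inl ℝ _ _ ∘ₗ LinearMap.single ℝ (fun i => E i →L[ℝ] E i) i)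
    choose Y hYs hY hYC using fun j => exists_isSymmetric_inner_eq_rankOne
      (f.toLinearMap ∘ₗ LinearMap.inr ℝ _ _ ∘ₗ LinearMap.single ℝ (fun j => F j →L[ℝ] F j) j)
    have hsum : ∀ (a : ∀ i, E i →L[ℝ] E i) (b : ∀ j, F j →L[ℝ] F j), f (a, b) =
        ∑ i, (f.toLinearMap ∘ₗ LinearMap.inl ℝ _ _ ∘ₗ
          LinearMap.single ℝ (fun i => E i →L[ℝ] E i) i) (a i) +
        ∑ j, (f.toLinearMap ∘ₗ LinearMap.inr ℝ _ _ ∘ₗ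
          LinearMap.single ℝ (fun j => F j →L[ℝ] F j) j) (b j) := by
      intro a b
      have ha : (a, b) =
          LinearMap.inl ℝ _ _ (∑ i, LinearMap.single ℝ (fun i => E i →L[ℝ] E i) i (a i)) +
          LinearMap.inr ℝ _ _ (∑ j, LinearMap.single ℝ (fun j => F j →L[ℝ] F j) j (b j)) := by
        simp [Finset.univ_sum_single]
      rw [ha, map_add, map_sum, map_sum, map_sum, map_sum]
      rfl
    have hpos := h X Y hXs hYs fun x => by
      have := hf _ ⟨_, InnerProductSpace.isPositive_rankOne_self x, rfl⟩
      rw [compression_rankOne, hsum] at this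
      simpa only [hX, hY] using this
    rw [hsum] at hf₀
    simp only [hXA _ _ (hA _), hYC _ _ (hC _)] at hf₀
    exact absurd hpos (not_le.2 hf₀)

theorem isGaussianExtremizer_of_extCond {c : Fin k → ℝ} {d : Fin m → ℝ}
    {B : ∀ i j, E i →ₗ[ℝ] F j} (hd : ∀ j, 0 ≤ d j) (hs : ScalingCond E F c d)
    {V : ∀ i, E i →ₗ[ℝ] E i} {P : PiLp 2 E →ₗ[ℝ] PiLp 2 E} (hV : ∀ i, PosDef (V i))
    (hP : P ∈ Coupling E fun i => Ring.inverse (V i)) (hext : ExtCond E F c d B V P)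
    {U : ∀ j, F j →ₗ[ℝ] F j} (hU : ∀ j, U j = Ring.inverse
      ((BLam E F c B j) ∘ₗ P ∘ₗ LinearMap.adjoint (BLam E F c B j))) :
    (∀ j, PosDef (U j)) ∧ GaussCon E F c d B V U ∧
      Dg E F c d B = (gaussObj E F c d V U : EReal) := by
  have hUpos : ∀ j, PosDef (U j) := fun j => by
    rw [hU]
    exact (hP.1.comp_comp_adjoint _).posDef_inverse (hext.1 j)
  have hcon : GaussCon E F c d B V U := by
    rw [gaussCon_iff]
    simpa only [hU] using hext.2
  refine ⟨hUpos, hcon, (Dg_eq_gaussObj_iff hV hUpos hcon).2 fun V' U' hV' hU' hcon' => ?_⟩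
  refine div_le_div_of_nonneg_right ?_ zero_le_two
  refine log_det_objective_le hd hs hV' hV hU' hUpos ((gaussCon_iff _ _ _ _ _).1 hcon')
    ((gaussCon_iff _ _ _ _ _).1 hcon) hP.1
    (fun i => eq_projL_comp_of_mem_coupling hP i (hV i).inverse.1) fun j => ?_
  rw [hU, inverse_inverse (hext.1 j)]

theorem PosDef.log_det_smul {G : Type*} [NormedAddCommGroup G] [InnerProductSpace ℝ G]
    [FiniteDimensional ℝ G] {A : G →ₗ[ℝ] G} (hA : PosDef A) {a : ℝ} (ha : a ≠ 0) :
    Real.log (LinearMap.det (a • A)) =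
      Module.finrank ℝ G * Real.log a + Real.log (LinearMap.det A) := by
  rw [LinearMap.det_smul, Real.log_mul (pow_ne_zero _ ha) (det_ne_zero_of_isUnit hA.isUnit),
    Real.log_pow]

theorem gaussObj_smul (c : Fin k → ℝ) (d : Fin m → ℝ) {V : ∀ i, E i →ₗ[ℝ] E i}
    {U : ∀ j, F j →ₗ[ℝ] F j} (hV : ∀ i, PosDef (V i)) (hU : ∀ j, PosDef (U j)) {a : ℝ}
    (ha : a ≠ 0) :
    gaussObj E F c d (fun i => a • V i) (fun j => a • U j) = gaussObj E F c d V U +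
      (∑ j, d j * (Module.finrank ℝ (F j) : ℝ) - ∑ i, c i * (Module.finrank ℝ (E i) : ℝ)) *
        Real.log a / 2 := by
  simp only [gaussObj, fun i => (hV i).log_det_smul ha,
    fun j => (hU j).log_det_smul ha, mul_add, Finset.sum_add_distrib, sub_mul,
    Finset.sum_mul, mul_assoc]
  ring

theorem scalingCond_of_isMax {c : Fin k → ℝ} {d : Fin m → ℝ} {B : ∀ i j, E i →ₗ[ℝ] F j}
    {V : ∀ i, E i →ₗ[ℝ] E i} {U : ∀ j, F j →ₗ[ℝ] F j} (hV : ∀ i, PosDef (V i))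
    (hU : ∀ j, PosDef (U j)) (hcon : GaussCon E F c d B V U)
    (hmax : ∀ V' U', (∀ i, PosDef (V' i)) → (∀ j, PosDef (U' j)) →
      GaussCon E F c d B V' U' → gaussObj E F c d V' U' ≤ gaussObj E F c d V U) :
    ScalingCond E F c d := by
  have key : ∀ {a : ℝ}, 0 < a → (∑ j, d j * (Module.finrank ℝ (F j) : ℝ) -
      ∑ i, c i * (Module.finrank ℝ (E i) : ℝ)) * Real.log a ≤ 0 := by
    intro a ha
    have := hmax _ _ (fun i => (hV i).smul ha) (fun j => (hU j).smul ha) fun x => by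
      have := mul_le_mul_of_nonneg_left (hcon x) ha.le
      simpa only [LinearMap.smul_apply, inner_smul_left, Finset.mul_sum, mul_left_comm,
        conj_trivial] using this
    rw [gaussObj_smul c d hV hU ha.ne'] at this
    linarith
  have h₁ := key (Real.exp_pos 1)
  have h₂ := key (Real.exp_pos (-1))
  rw [Real.log_exp] at h₁ h₂
  unfold ScalingCond
  linarith

/-- First-order optimality of a gaussian extremizer along a feasible ray. -/
theorem trace_nonneg_of_isMax {c : Fin k → ℝ} {d : Fin m → ℝ} {B : ∀ i j, E i →ₗ[ℝ] F j}
    (hc : ∀ i, 0 < c i) (hd : ∀ j, 0 < d j)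
    {V : ∀ i, E i →ₗ[ℝ] E i} {U : ∀ j, F j →ₗ[ℝ] F j} (hV : ∀ i, PosDef (V i))
    (hU : ∀ j, PosDef (U j)) (hcon : GaussCon E F c d B V U)
    (hmax : ∀ V' U', (∀ i, PosDef (V' i)) → (∀ j, PosDef (U' j)) →
      GaussCon E F c d B V' U' → gaussObj E F c d V' U' ≤ gaussObj E F c d V U)
    {X : ∀ i, E i →ₗ[ℝ] E i} {Y : ∀ j, F j →ₗ[ℝ] F j}
    (hX : ∀ i, (X i).IsSymmetric) (hY : ∀ j, (Y j).IsSymmetric)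
    (hXY : ∀ x, 0 ≤ ∑ i, ⟪X i (projL E i x), projL E i x⟫ +
      ∑ j, ⟪Y j (BLam E F c B j x), BLam E F c B j x⟫) :
    0 ≤ ∑ i, LinearMap.trace ℝ (E i) (X i * Ring.inverse (V i)) +
      ∑ j, LinearMap.trace ℝ (F j) (Y j * Ring.inverse (U j)) := by
  let Vt : ℝ → ∀ i, E i →ₗ[ℝ] E i := fun t i => V i + t • ((c i)⁻¹ • X i)
  let Ut : ℝ → ∀ j, F j →ₗ[ℝ] F j := fun t j => U j + t • (-(d j)⁻¹ • Y j)
  have hder : HasDerivAt (fun t => gaussObj E F c d (Vt t) (Ut t))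
      ((∑ j, d j * LinearMap.trace ℝ (F j)
          (Ring.inverse (U j + (0 : ℝ) • (-(d j)⁻¹ • Y j)) * (-(d j)⁻¹ • Y j)) -
        ∑ i, c i * LinearMap.trace ℝ (E i)
          (Ring.inverse (V i + (0 : ℝ) • ((c i)⁻¹ • X i)) * ((c i)⁻¹ • X i))) / 2) 0 := by
    refine HasDerivAt.div_const (HasDerivAt.sub ?_ ?_) 2
    · refine HasDerivAt.fun_sum fun j _ => (hasDerivAt_log_det_add_smul _ _ _ ?_).const_mul _
      simpa using (hU j).isUnit
    · refine HasDerivAt.fun_sum fun i _ => (hasDerivAt_log_det_add_smul _ _ _ ?_).const_mul _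
      simpa using (hV i).isUnit
  have hval : (∑ j, d j * LinearMap.trace ℝ (F j)
          (Ring.inverse (U j + (0 : ℝ) • (-(d j)⁻¹ • Y j)) * (-(d j)⁻¹ • Y j)) -
        ∑ i, c i * LinearMap.trace ℝ (E i)
          (Ring.inverse (V i + (0 : ℝ) • ((c i)⁻¹ • X i)) * ((c i)⁻¹ • X i))) / 2 =
      -(∑ i, LinearMap.trace ℝ (E i) (X i * Ring.inverse (V i)) +
        ∑ j, LinearMap.trace ℝ (F j) (Y j * Ring.inverse (U j))) / 2 := by
    have h₁ : ∀ j, d j * LinearMap.trace ℝ (F j)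
        (Ring.inverse (U j + (0 : ℝ) • (-(d j)⁻¹ • Y j)) * (-(d j)⁻¹ • Y j)) =
        -LinearMap.trace ℝ (F j) (Y j * Ring.inverse (U j)) := fun j => by
      rw [zero_smul, add_zero, mul_smul_comm, map_smul, smul_eq_mul, LinearMap.trace_mul_comm,
        neg_mul, mul_neg, mul_inv_cancel_left₀ (hd j).ne']
    have h₂ : ∀ i, c i * LinearMap.trace ℝ (E i)
        (Ring.inverse (V i + (0 : ℝ) • ((c i)⁻¹ • X i)) * ((c i)⁻¹ • X i)) =
        LinearMap.trace ℝ (E i) (X i * Ring.inverse (V i)) := fun i => by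
      rw [zero_smul, add_zero, mul_smul_comm, map_smul, smul_eq_mul, LinearMap.trace_mul_comm,
        mul_inv_cancel_left₀ (hc i).ne']
    simp only [h₁, h₂, Finset.sum_neg_distrib]
    ring
  have hfeas : ∀ t : ℝ, 0 < t → GaussCon E F c d B (Vt t) (Ut t) := by
    intro t ht
    rw [gaussCon_iff] at hcon ⊢
    intro x
    have h₁ : ∀ j, d j * ⟪Ut t j (BLam E F c B j x), BLam E F c B j x⟫ =
        d j * ⟪U j (BLam E F c B j x), BLam E F c B j x⟫ -
          t * ⟪Y j (BLam E F c B j x), BLam E F c B j x⟫ := fun j => by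
      have := (hd j).ne'
      simp only [Ut, LinearMap.add_apply, LinearMap.smul_apply, inner_add_left, inner_smul_left,
        conj_trivial]
      field_simp
      ring
    have h₂ : ∀ i, c i * ⟪Vt t i (projL E i x), projL E i x⟫ =
        c i * ⟪V i (projL E i x), projL E i x⟫ +
          t * ⟪X i (projL E i x), projL E i x⟫ := fun i => by
      have := (hc i).ne'
      simp only [Vt, LinearMap.add_apply, LinearMap.smul_apply, inner_add_left, inner_smul_left,
        conj_trivial]
      field_simp
    simp only [h₁, h₂, Finset.sum_sub_distrib, Finset.sum_add_distrib, ← Finset.mul_sum]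
    linarith [hcon x, mul_nonneg ht.le (hXY x)]
  have hpos : ∀ᶠ t in nhds (0 : ℝ), (∀ i, PosDef (Vt t i)) ∧ ∀ j, PosDef (Ut t j) :=
    (Filter.eventually_all.2 fun i => (hV i).eventually_add_smul ((hX i).smul (by simp))).and
      (Filter.eventually_all.2 fun j => (hU j).eventually_add_smul ((hY j).smul (by simp)))
  have hle := le_of_tendsto hder.tendsto_slope_zero_right (b := 0) <| by
    filter_upwards [self_mem_nhdsWithin, nhdsWithin_le_nhds hpos] with t ht htpos
    refine mul_nonpos_of_nonneg_of_nonpos (inv_nonneg.2 (le_of_lt ht)) (sub_nonpos.2 ?_)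
    have := hmax _ _ htpos.1 htpos.2 (hfeas t ht)
    simpa [Vt, Ut] using this
  rw [hval] at hle
  linarith

theorem exists_coupling_of_gaussExt {c : Fin k → ℝ} {d : Fin m → ℝ}
    {B : ∀ i j, E i →ₗ[ℝ] F j} (hc : ∀ i, 0 < c i) (hd : ∀ j, 0 < d j)
    (h : GaussExt E F c d B) :
    ScalingCond E F c d ∧
      ∃ (V : ∀ i, E i →ₗ[ℝ] E i) (P : PiLp 2 E →ₗ[ℝ] PiLp 2 E),
        (∀ i, PosDef (V i)) ∧ P ∈ Coupling E (fun i => Ring.inverse (V i)) ∧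
          ExtCond E F c d B V P := by
  obtain ⟨V, U, hV, hU, hcon, hDg⟩ := h
  have hmax := (Dg_eq_gaussObj_iff hV hU hcon).1 hDg
  obtain ⟨P, hP, hPV, hPU⟩ := exists_posSemidef_multiplier (BLam E F c B)
    (fun i => (hV i).inverse.posSemidef) (fun j => (hU j).inverse.posSemidef)
    fun X Y hX hY hXY => trace_nonneg_of_isMax hc hd hV hU hcon hmax hX hY hXY
  refine ⟨scalingCond_of_isMax hV hU hcon hmax, V, P, hV, ⟨hP, fun i v => ?_⟩, fun j => ?_, ?_⟩
  · dsimp only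
    rw [hPV, real_inner_comm, inner_singleL_left, adjoint_projL, real_inner_comm]
    rfl
  · rw [← hPU]
    exact (hU j).inverse.isUnit
  · simp only [← hPU, inverse_inverse (hU _).isUnit]
    exact (gaussCon_iff _ _ _ _ _).1 hcon

end Datum
end FRBL

namespace FRBL

variable {k m : ℕ}
  (E : Fin k → Type*) (F : Fin m → Type*)
  [∀ i, NormedAddCommGroup (E i)] [∀ i, InnerProductSpace ℝ (E i)]
  [∀ i, FiniteDimensional ℝ (E i)]
  [∀ i, MeasurableSpace (E i)] [∀ i, BorelSpace (E i)]
  [∀ j, NormedAddCommGroup (F j)] [∀ j, InnerProductSpace ℝ (F j)]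
  [∀ j, FiniteDimensional ℝ (F j)]
  [∀ j, MeasurableSpace (F j)] [∀ j, BorelSpace (F j)]

/-- **Theorem (structure of gaussian extremizers).** A datum `(c,d,B)` is
gaussian-extremizable if and only if the scaling condition holds and there are
positive-definite `Vᵢ` and `Π ∈ Π(V₁⁻¹,…,V_k⁻¹)` such that each `B_j Λ_c Π Λ_c B_j*` is
invertible and `∑ⱼ dⱼ Λ_c B_j* (B_j Λ_c Π Λ_c B_j*)⁻¹ B_j Λ_c ≤ ⊕ᵢ cᵢ Vᵢ`.  Moreover, any
such `(Vᵢ)` together with `Uⱼ := (B_j Λ_c Π Λ_c B_j*)⁻¹` are gaussian extremizers. -/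
theorem gaussExt_iff_structure
    (c : Fin k → ℝ) (d : Fin m → ℝ) (B : ∀ i j, E i →ₗ[ℝ] F j)
    (hc : ∀ i, 0 < c i) (hd : ∀ j, 0 < d j) :
    (GaussExt E F c d B ↔
      ScalingCond E F c d ∧
      ∃ (V : ∀ i, E i →ₗ[ℝ] E i) (P : PiLp 2 E →ₗ[ℝ] PiLp 2 E),
        (∀ i, PosDef (V i)) ∧
        P ∈ Coupling E (fun i => Ring.inverse (V i)) ∧
        ExtCond E F c d B V P) ∧
    (∀ (V : ∀ i, E i →ₗ[ℝ] E i) (P : PiLp 2 E →ₗ[ℝ] PiLp 2 E),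
      ScalingCond E F c d → (∀ i, PosDef (V i)) →
      P ∈ Coupling E (fun i => Ring.inverse (V i)) →
      ExtCond E F c d B V P →
      (∀ j, PosDef (Ring.inverse
          ((BLam E F c B j) ∘ₗ P ∘ₗ LinearMap.adjoint (BLam E F c B j)))) ∧
      GaussCon E F c d B V (fun j => Ring.inverse
          ((BLam E F c B j) ∘ₗ P ∘ₗ LinearMap.adjoint (BLam E F c B j))) ∧
      Dg E F c d B = (gaussObj E F c d V (fun j => Ring.inverse
          ((BLam E F c B j) ∘ₗ P ∘ₗ LinearMap.adjoint (BLam E F c B j))) : EReal)) := by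
  refine ⟨⟨exists_coupling_of_gaussExt hc hd, ?_⟩, fun V P hs hV hP hext =>
    isGaussianExtremizer_of_extCond (fun j => (hd j).le) hs hV hP hext fun _ => rfl⟩
  rintro ⟨hs, V, P, hV, hP, hext⟩
  have := isGaussianExtremizer_of_extCond (fun j => (hd j).le) hs hV hP hext fun _ => rfl
  exact ⟨V, _, hV, this.1, this.2.1, this.2.2⟩

end FRBL
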